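/- arXiv:2412.19192 — 11 statements merged into one kernel-verified Lean document; each statement's English description precedes it below -/
import Mathlib

section
/- Let (N, v) be a coalitional game with n = |N| players whose utility function v is nonnegative and monotone. Then for every player i ∈ N, the maximum marginal contribution satisfies U_{max,i} ≤ n · C(n−1, ⌊(n−1)/2⌋) · φ_i, where φ_i is the Shapley value of i. In particular, the max-to-mean ratio satisfies Γ ≤ n · C(n−1, ⌊(n−1)/2⌋). -/
/-- For a nonnegative monotone coalitional game `(N, v)` with `n` players, every player `i`'s
maximum marginal contribution `U_{max,i}` is at most `n * C(n-1, ⌊(n-1)/2⌋)` times its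
Shapley value `φ_i`; hence the max-to-mean ratio satisfies `Γ ≤ n * C(n-1, ⌊(n-1)/2⌋)`. -/
theorem gamma_ratio_monotone_games
    {N : Type*} [Fintype N] [DecidableEq N]
    (v : Finset N → ℝ)
    (hnonneg : ∀ S : Finset N, 0 ≤ v S)
    (hmono : ∀ S T : Finset N, S ⊆ T → v S ≤ v T)
    (n : ℕ) (hn : n = Fintype.card N) (i : N) :
    ((Finset.univ.erase i).powerset.sup' ⟨∅, Finset.empty_mem_powerset _⟩
        (fun S => v (insert i S) - v S))
      ≤ (n : ℝ) * ((n - 1).choose ((n - 1) / 2) : ℝ) *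
        ((1 / (n : ℝ)) * ∑ S ∈ (Finset.univ.erase i).powerset,
          (((n - 1).choose S.card : ℝ))⁻¹ * (v (insert i S) - v S)) := by
  have hn0 : (n : ℝ) ≠ 0 := by
    rw [hn]
    exact_mod_cast (Fintype.card_pos_iff.mpr ⟨i⟩).ne'
  have hmarginal : ∀ S : Finset N, 0 ≤ v (insert i S) - v S := fun S =>
    sub_nonneg.mpr (hmono _ _ (Finset.subset_insert i S))
  apply Finset.sup'_le
  intro S hS
  have hcard : S.card ≤ n - 1 := by
    have h := Finset.card_le_card (Finset.mem_powerset.mp hS)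
    rwa [Finset.card_erase_of_mem (Finset.mem_univ i), Finset.card_univ, ← hn] at h
  have hpos : (0 : ℝ) < (n - 1).choose S.card := by
    exact_mod_cast Nat.choose_pos hcard
  have hle : ((n - 1).choose S.card : ℝ) ≤ (n - 1).choose ((n - 1) / 2) := by
    exact_mod_cast Nat.choose_le_middle S.card (n - 1)
  have hterm := Finset.single_le_sum
    (f := fun T : Finset N => (((n - 1).choose T.card : ℝ))⁻¹ * (v (insert i T) - v T))
    (fun T _ => mul_nonneg (by positivity) (hmarginal T)) hS
  calc v (insert i S) - v S
      = ((n - 1).choose S.card : ℝ) *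
          (((n - 1).choose S.card : ℝ)⁻¹ * (v (insert i S) - v S)) := by
        rw [mul_inv_cancel_left₀ hpos.ne']
    _ ≤ ((n - 1).choose ((n - 1) / 2) : ℝ) *
          ∑ T ∈ (Finset.univ.erase i).powerset,
            (((n - 1).choose T.card : ℝ))⁻¹ * (v (insert i T) - v T) :=
        mul_le_mul hle hterm (mul_nonneg (by positivity) (hmarginal S)) (by positivity)
    _ = _ := by field_simp
end

section
/- Let N be a finite set of n ≥ 2 players, and let S₀ ⊆ N with |S₀| = ⌊(n−1)/2⌋. Define the utility function v : 2^N → ℝ by v(S) = 1 if S₀ ⊊ S and v(S) = 0 otherwise. Then for every player i ∉ S₀: (a) μ_i(S) = 1 if S = S₀ and μ_i(S) = 0 for every other S ⊆ N\{i}; (b) the Shapley value of i equals φ_i = (1/n) · C(n−1, ⌊(n−1)/2⌋)^{−1}; (c) U_{max,i} = 1, and hence Γ_i = n · C(n−1, ⌊(n−1)/2⌋). -/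
/-- If `a ∉ s`, then `insert a t` strictly contains `s` iff `t` contains `s`. -/
theorem Finset.ssubset_insert_iff_subset_of_notMem {α : Type*} [DecidableEq α] {s t : Finset α}
    {a : α} (hs : a ∉ s) : s ⊂ insert a t ↔ s ⊆ t := by
  rw [← Finset.subset_insert_iff_of_notMem hs (t := t), Finset.ssubset_iff_subset_ne]
  exact and_iff_left fun h => hs (h ▸ Finset.mem_insert_self a t)

/-- For the game `v(S) = 1` iff `S₀ ⊊ S` (else `0`), where `|S₀| = ⌊(n-1)/2⌋`, and any
player `i ∉ S₀`: (a) the marginal contribution `μ_i(S)` is `1` exactly when `S = S₀` and `0`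
for every other `S ⊆ N \ {i}`; (b) the Shapley value of `i` is `(1/n) * C(n-1, ⌊(n-1)/2⌋)⁻¹`;
(c) `U_{max,i} = 1`, and hence `Γ_i = n * C(n-1, ⌊(n-1)/2⌋)`. -/
theorem max_gamma_game
    {N : Type*} [Fintype N] [DecidableEq N]
    (n : ℕ) (hn : n = Fintype.card N) (hn2 : 2 ≤ n)
    (S₀ : Finset N) (hS₀ : S₀.card = (n - 1) / 2)
    (v : Finset N → ℝ)
    (hv : ∀ S : Finset N, v S = if S₀ ⊂ S then 1 else 0)
    (i : N) (hi : i ∉ S₀) :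
    (∀ S ∈ (Finset.univ.erase i).powerset,
        v (insert i S) - v S = if S = S₀ then 1 else 0) ∧
    ((1 / (n : ℝ)) * ∑ S ∈ (Finset.univ.erase i).powerset,
        (((n - 1).choose S.card : ℝ))⁻¹ * (v (insert i S) - v S)
      = (1 / (n : ℝ)) * (((n - 1).choose ((n - 1) / 2) : ℝ))⁻¹) ∧
    ((Finset.univ.erase i).powerset.sup' ⟨∅, Finset.empty_mem_powerset _⟩
        (fun S => v (insert i S) - v S) = 1) ∧
    (((Finset.univ.erase i).powerset.sup' ⟨∅, Finset.empty_mem_powerset _⟩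
        (fun S => v (insert i S) - v S)) /
      ((1 / (n : ℝ)) * ∑ S ∈ (Finset.univ.erase i).powerset,
        (((n - 1).choose S.card : ℝ))⁻¹ * (v (insert i S) - v S))
      = (n : ℝ) * ((n - 1).choose ((n - 1) / 2) : ℝ)) := by
  have marginal : ∀ S ∈ (Finset.univ.erase i).powerset,
      v (insert i S) - v S = if S = S₀ then 1 else 0 := by
    intro S _
    simp only [hv, Finset.ssubset_insert_iff_subset_of_notMem hi]
    rcases eq_or_ne S S₀ with rfl | hne
    · simp
    · simp [Finset.ssubset_iff_subset_ne, hne, hne.symm]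
  have hmem : S₀ ∈ (Finset.univ.erase i).powerset :=
    Finset.mem_powerset.2 (Finset.subset_erase.2 ⟨Finset.subset_univ _, hi⟩)
  have shapley : ∑ S ∈ (Finset.univ.erase i).powerset,
      (((n - 1).choose S.card : ℝ))⁻¹ * (v (insert i S) - v S)
        = (((n - 1).choose ((n - 1) / 2) : ℝ))⁻¹ := by
    rw [Finset.sum_eq_single_of_mem S₀ hmem fun S hS hne => by simp [marginal S hS, hne],
      marginal S₀ hmem, hS₀]
    simp
  have hmax : (Finset.univ.erase i).powerset.sup' ⟨∅, Finset.empty_mem_powerset _⟩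
      (fun S => v (insert i S) - v S) = 1 := by
    refine le_antisymm (Finset.sup'_le _ _ fun S hS => ?_)
      (Finset.le_sup'_of_le _ hmem (by simp [marginal S₀ hmem]))
    rw [marginal S hS]
    split_ifs <;> norm_num
  refine ⟨marginal, by rw [shapley], hmax, ?_⟩
  rw [hmax, shapley]
  simp [mul_comm]
end

section
/- Let (N, v) be a coalitional game with n players whose utility function v is supermodular, and fix a player i* ∈ N. For j ∈ {1, …, n}, let U_j := C(n−1, j−1)^{−1} · Σ_{T ⊆ N\{i*}, |T| = j−1} μ_{i*}(T) (the expected reward of i* conditioned on having rank j in a uniformly random permutation). Then for all 1 ≤ j < n, U_j ≤ U_{j+1}. -/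
/-- Double counting of pairs `x ∉ T` with `T` of size `k` against pairs `x ∈ T` with `T` of
size `k + 1`. -/
theorem Finset.sum_powersetCard_sdiff_eq {α M : Type*} [DecidableEq α] [AddCommMonoid M]
    (A : Finset α) (k : ℕ) (f : Finset α → M) :
    ∑ T ∈ A.powersetCard k, ∑ x ∈ A \ T, f (insert x T) =
      (k + 1) • ∑ T ∈ A.powersetCard (k + 1), f T := by
  have h : ∑ T ∈ A.powersetCard (k + 1), ∑ _x ∈ T, f T =
      (k + 1) • ∑ T ∈ A.powersetCard (k + 1), f T := by
    rw [Finset.smul_sum]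
    refine Finset.sum_congr rfl fun T hT => ?_
    rw [Finset.sum_const, (Finset.mem_powersetCard.1 hT).2]
  rw [← h, Finset.sum_sigma', Finset.sum_sigma']
  refine Finset.sum_bij' (fun p _ => ⟨insert p.2 p.1, p.2⟩) (fun p _ => ⟨p.1.erase p.2, p.2⟩)
    ?_ ?_ ?_ ?_ ?_
  · rintro ⟨T, x⟩ hp
    simp only [Finset.mem_sigma, Finset.mem_powersetCard, Finset.mem_sdiff] at hp ⊢
    obtain ⟨⟨hT, hk⟩, hx, hxT⟩ := hp
    exact ⟨⟨Finset.insert_subset hx hT, by rw [Finset.card_insert_of_notMem hxT, hk]⟩,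
      Finset.mem_insert_self x T⟩
  · rintro ⟨T, x⟩ hp
    simp only [Finset.mem_sigma, Finset.mem_powersetCard, Finset.mem_sdiff] at hp ⊢
    obtain ⟨⟨hT, hk⟩, hx⟩ := hp
    exact ⟨⟨(Finset.erase_subset x T).trans hT, by rw [Finset.card_erase_of_mem hx, hk]; rfl⟩,
      hT hx, Finset.notMem_erase x T⟩
  · rintro ⟨T, x⟩ hp
    simp only [Finset.mem_sigma, Finset.mem_sdiff] at hp
    simp [Finset.erase_insert hp.2.2]
  · rintro ⟨T, x⟩ hp
    simp only [Finset.mem_sigma] at hp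
    simp [Finset.insert_erase hp.2]
  · rintro ⟨T, x⟩ _
    rfl

/-- If adding an element never decreases `f`, the average of `f` over the `k`-subsets of `A` is at
most its average over the `(k + 1)`-subsets. -/
theorem Finset.average_powersetCard_le_succ {α : Type*} [DecidableEq α] (A : Finset α) {k : ℕ}
    (hk : k < A.card) (f : Finset α → ℝ)
    (hf : ∀ T ⊆ A, ∀ x ∈ A \ T, f T ≤ f (insert x T)) :
    ((A.card.choose k : ℝ))⁻¹ * ∑ T ∈ A.powersetCard k, f T ≤
      ((A.card.choose (k + 1) : ℝ))⁻¹ * ∑ T ∈ A.powersetCard (k + 1), f T := by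
  have hsum : ((A.card - k : ℕ) : ℝ) * ∑ T ∈ A.powersetCard k, f T ≤
      ((k + 1 : ℕ) : ℝ) * ∑ T ∈ A.powersetCard (k + 1), f T := by
    rw [← nsmul_eq_mul (k + 1), ← Finset.sum_powersetCard_sdiff_eq, Finset.mul_sum]
    refine Finset.sum_le_sum fun T hT => ?_
    obtain ⟨hTA, hTk⟩ := Finset.mem_powersetCard.1 hT
    rw [← hTk, ← Finset.card_sdiff_of_subset hTA, ← nsmul_eq_mul]
    exact Finset.card_nsmul_le_sum _ _ _ (hf T hTA)
  have hchoose : (A.card.choose (k + 1) : ℝ) * ((k + 1 : ℕ) : ℝ) =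
      A.card.choose k * ((A.card - k : ℕ) : ℝ) := by
    exact_mod_cast Nat.choose_succ_right_eq A.card k
  have h₀ : (0 : ℝ) < A.card.choose k := by exact_mod_cast Nat.choose_pos hk.le
  have h₁ : (0 : ℝ) < A.card.choose (k + 1) := by exact_mod_cast Nat.choose_pos hk
  have h₂ : (0 : ℝ) < ((k + 1 : ℕ) : ℝ) := by positivity
  rw [inv_mul_eq_div, inv_mul_eq_div, div_le_div_iff₀ h₀ h₁]
  refine le_of_mul_le_mul_right ?_ h₂
  calc (∑ T ∈ A.powersetCard k, f T) * A.card.choose (k + 1) * ((k + 1 : ℕ) : ℝ)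
      = A.card.choose k * (((A.card - k : ℕ) : ℝ) * ∑ T ∈ A.powersetCard k, f T) := by
        rw [mul_assoc, hchoose]; ring
    _ ≤ A.card.choose k * (((k + 1 : ℕ) : ℝ) * ∑ T ∈ A.powersetCard (k + 1), f T) :=
        mul_le_mul_of_nonneg_left hsum h₀.le
    _ = _ := by ring

/-- In a supermodular game, the marginal contribution of `i` does not decrease when another player
joins the coalition. -/
theorem marginal_le_marginal_insert_of_supermodular {N : Type*} [DecidableEq N]
    {v : Finset N → ℝ} (hsup : ∀ S T : Finset N, v S + v T ≤ v (S ∪ T) + v (S ∩ T))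
    {i x : N} {T : Finset N} (hi : i ∉ T) (hxi : x ≠ i) :
    v (insert i T) - v T ≤ v (insert i (insert x T)) - v (insert x T) := by
  have h := hsup (insert i T) (insert x T)
  have hunion : insert i T ∪ insert x T = insert i (insert x T) := by grind
  have hinter : insert i T ∩ insert x T = T := by grind
  rw [hunion, hinter] at h
  linarith

/-- In a supermodular game, the expected reward of a player conditioned on its rank in a
uniformly random permutation is monotone in the rank: for `1 ≤ j < n`, `U_j ≤ U_{j+1}`,
where `U_j := C(n-1, j-1)⁻¹ * Σ_{T ⊆ N\{i*}, |T| = j-1} μ_{i*}(T)`. -/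
theorem monotonicity_of_ranks
    {N : Type*} [Fintype N] [DecidableEq N]
    (v : Finset N → ℝ)
    (hsup : ∀ S T : Finset N, v S + v T ≤ v (S ∪ T) + v (S ∩ T))
    (n : ℕ) (hn : n = Fintype.card N) (istar : N)
    (U : ℕ → ℝ)
    (hU : ∀ j : ℕ, U j = (((n - 1).choose (j - 1) : ℝ))⁻¹ *
        ∑ T ∈ Finset.powersetCard (j - 1) (Finset.univ.erase istar),
          (v (insert istar T) - v T))
    (j : ℕ) (hj1 : 1 ≤ j) (hjn : j < n) :
    U j ≤ U (j + 1) := by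
  obtain ⟨k, rfl⟩ : ∃ k, j = k + 1 := ⟨j - 1, by omega⟩
  have hcard : (Finset.univ.erase istar).card = n - 1 := by
    rw [Finset.card_erase_of_mem (Finset.mem_univ _), Finset.card_univ, hn]
  rw [hU, hU, Nat.add_sub_cancel, Nat.add_sub_cancel, ← hcard]
  refine Finset.average_powersetCard_le_succ _ (by omega)
    (fun T => v (insert istar T) - v T) fun T hT x hx => ?_
  refine marginal_le_marginal_insert_of_supermodular hsup
    (fun h => Finset.ne_of_mem_erase (hT h) rfl) ?_
  exact Finset.ne_of_mem_erase (Finset.mem_sdiff.1 hx).1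
end

section
/- Let (N, v) be a coalitional game with n players whose utility function v is nonnegative, monotone and supermodular. Then for every player i, U_{max,i} ≤ n · φ_i; in particular the max-to-mean ratio satisfies Γ ≤ n. -/
/-- Marginal contributions in a supermodular game are maximal at the complement of the player. -/
theorem marginal_le_marginal_univ_erase {N : Type*} [Fintype N] [DecidableEq N]
    {v : Finset N → ℝ} (hsup : ∀ S T : Finset N, v S + v T ≤ v (S ∪ T) + v (S ∩ T))
    {i : N} {S : Finset N} (hS : S ⊆ Finset.univ.erase i) :
    v (insert i S) - v S
      ≤ v (insert i (Finset.univ.erase i)) - v (Finset.univ.erase i) := by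
  have hunion : insert i S ∪ Finset.univ.erase i = insert i (Finset.univ.erase i) := by
    rw [Finset.insert_union, Finset.union_eq_right.mpr hS]
  have hinter : insert i S ∩ Finset.univ.erase i = S := by
    rw [Finset.insert_inter_of_notMem (Finset.notMem_erase i _), Finset.inter_eq_left.mpr hS]
  have h := hsup (insert i S) (Finset.univ.erase i)
  rw [hunion, hinter] at h
  linarith


/-- For a nonnegative, monotone and supermodular game, every player `i` satisfies
`U_{max,i} ≤ n * φ_i`; in particular the max-to-mean ratio satisfies `Γ ≤ n`. -/
theorem gamma_ratio_supermodular_games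
    {N : Type*} [Fintype N] [DecidableEq N] [Nonempty N]
    (v : Finset N → ℝ)
    (hnonneg : ∀ S : Finset N, 0 ≤ v S)
    (hmono : ∀ S T : Finset N, S ⊆ T → v S ≤ v T)
    (hsup : ∀ S T : Finset N, v S + v T ≤ v (S ∪ T) + v (S ∩ T))
    (n : ℕ) (hn : n = Fintype.card N) :
    (∀ i : N,
      ((Finset.univ.erase i).powerset.sup' ⟨∅, Finset.empty_mem_powerset _⟩
          (fun S => v (insert i S) - v S))
        ≤ (n : ℝ) * ((1 / (n : ℝ)) * ∑ S ∈ (Finset.univ.erase i).powerset,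
            (((n - 1).choose S.card : ℝ))⁻¹ * (v (insert i S) - v S))) ∧
    (Finset.univ.sup' Finset.univ_nonempty
        (fun i : N =>
          ((Finset.univ.erase i).powerset.sup' ⟨∅, Finset.empty_mem_powerset _⟩
            (fun S => v (insert i S) - v S)) /
          ((1 / (n : ℝ)) * ∑ S ∈ (Finset.univ.erase i).powerset,
            (((n - 1).choose S.card : ℝ))⁻¹ * (v (insert i S) - v S)))
      ≤ (n : ℝ)) := by
  have hn0 : (n : ℝ) ≠ 0 := by
    rw [hn]
    exact_mod_cast Fintype.card_ne_zero
  have hterm : ∀ (i : N) (S : Finset N),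
      0 ≤ (((n - 1).choose S.card : ℝ))⁻¹ * (v (insert i S) - v S) := fun i S =>
    mul_nonneg (by positivity) (sub_nonneg.mpr (hmono _ _ (Finset.subset_insert i S)))
  have hmax : ∀ i : N,
      ((Finset.univ.erase i).powerset.sup' ⟨∅, Finset.empty_mem_powerset _⟩
          (fun S => v (insert i S) - v S))
        ≤ (n : ℝ) * ((1 / (n : ℝ)) * ∑ S ∈ (Finset.univ.erase i).powerset,
            (((n - 1).choose S.card : ℝ))⁻¹ * (v (insert i S) - v S)) := by
    intro i
    rw [← mul_assoc, mul_one_div_cancel hn0, one_mul]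
    refine Finset.sup'_le _ _ fun S hS =>
      (marginal_le_marginal_univ_erase hsup (Finset.mem_powerset.mp hS)).trans ?_
    have hcard : (Finset.univ.erase i).card = n - 1 := by
      rw [Finset.card_erase_of_mem (Finset.mem_univ i), Finset.card_univ, hn]
    have h := Finset.single_le_sum (fun S _ => hterm i S)
      (Finset.mem_powerset_self (Finset.univ.erase i))
    rwa [hcard, Nat.choose_self, Nat.cast_one, inv_one, one_mul] at h
  refine ⟨hmax, Finset.sup'_le _ _ fun i _ => div_le_of_le_mul₀ ?_ n.cast_nonneg (hmax i)⟩
  exact mul_nonneg (by positivity) (Finset.sum_nonneg fun S _ => hterm i S)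
end

section
/- Let (N, v) be a coalitional game with n players. For every player i, the average over all n! permutations σ of N of the marginal contribution of i over its predecessors equals the subset form of the Shapley value: (1/n!) Σ_σ μ_i(P_i(σ)) = (1/n) Σ_{S ⊆ N\{i}} C(n−1,|S|)^{−1} μ_i(S) = Σ_{S ⊆ N\{i}} (|S|! · (n−1−|S|)! / n!) · μ_i(S), where P_i(σ) denotes the set of players preceding i in the permutation σ. -/
open Finset Nat in
lemma Numbering.card_filter_lt {X : Type*} [Fintype X] (f : Numbering X) (i : X) :
    #{j | f j < f i} = (f i : ℕ) := by
  have h : ({j | f j < f i} : Finset X).map f.toEmbedding = Iio (f i) := by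
    ext k
    simp only [mem_map_equiv, mem_filter_univ, Equiv.apply_symm_apply, mem_Iio]
  rw [← card_map f.toEmbedding, h, Fin.card_Iio]

open Finset Nat in
lemma Numbering.filter_lt_eq_iff {X : Type*} [Fintype X] [DecidableEq X] (f : Numbering X)
    {i : X} {s : Finset X} (hi : i ∉ s) :
    ({j | f j < f i} : Finset X) = s ↔ IsPrefix f (insert i s) ∧ (f i : ℕ) = #s := by
  constructor
  · intro h
    have hc : (f i : ℕ) = #s := by rw [← h, card_filter_lt]
    refine ⟨fun x ↦ ?_, hc⟩
    rw [card_insert_of_notMem hi, ← hc, Nat.lt_succ_iff, ← Fin.le_def, le_iff_eq_or_lt,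
      f.injective.eq_iff, mem_insert, ← h, mem_filter_univ]
  · rintro ⟨hp, hc⟩
    ext x
    have hx := hp x
    rw [card_insert_of_notMem hi, mem_insert] at hx
    rw [mem_filter_univ, Fin.lt_def, hc]
    by_cases hxi : x = i
    · subst hxi
      simp [hc, hi]
    · have hne : (f x : ℕ) ≠ #s := fun h ↦ hxi (f.injective (Fin.ext (h.trans hc.symm)))
      simp only [hxi, false_or] at hx
      rw [hx]
      omega

open Finset Nat in
lemma Numbering.card_filter_prefixed_apply_eq {X : Type*} [Fintype X] [DecidableEq X]
    {t : Finset X} {i j : X} (hi : i ∈ t) (hj : j ∈ t) (k : Fin (Fintype.card X)) :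
    #{f ∈ prefixed t | f i = k} = #{f ∈ prefixed t | f j = k} := by
  have hmem (x : X) : Equiv.swap i j x ∈ t ↔ x ∈ t := by
    rw [Equiv.swap_apply_def]
    split_ifs with h₁ h₂ <;> simp_all
  have hp (f : Numbering X) (hf : IsPrefix f t) : IsPrefix ((Equiv.swap i j).trans f) t :=
    fun x ↦ (hmem x).symm.trans (hf _)
  refine card_nbij' (fun f ↦ (Equiv.swap i j).trans f) (fun f ↦ (Equiv.swap i j).trans f)
    ?_ ?_ ?_ ?_
  · intro f hf
    simp only [coe_filter, mem_prefixed, Set.mem_ofPred_eq] at hf ⊢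
    exact ⟨hp f hf.1, by simp [hf.2]⟩
  · intro f hf
    simp only [coe_filter, mem_prefixed, Set.mem_ofPred_eq] at hf ⊢
    exact ⟨hp f hf.1, by simp [hf.2]⟩
  · intro f _
    ext x
    simp
  · intro f _
    ext x
    simp

open Finset Nat in
lemma Numbering.card_filter_lt_eq {X : Type*} [Fintype X] [DecidableEq X]
    {i : X} {s : Finset X} (hi : i ∉ s) :
    #{f : Numbering X | ({j | f j < f i} : Finset X) = s} =
      (#s)! * (Fintype.card X - 1 - #s)! := by
  have hcard : #(insert i s) = #s + 1 := card_insert_of_notMem hi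
  have hs : #s < Fintype.card X := by
    have := (insert i s).card_le_univ
    omega
  let k : Fin (Fintype.card X) := ⟨#s, hs⟩
  have hfilter : ({f : Numbering X | ({j | f j < f i} : Finset X) = s} : Finset (Numbering X)) =
      {f ∈ prefixed (insert i s) | f i = k} := by
    ext f
    simp only [mem_filter, mem_univ, true_and, mem_prefixed, filter_lt_eq_iff f hi, Fin.ext_iff, k]
  have hsum : #(prefixed (insert i s)) =
      (#s + 1) * #{f ∈ prefixed (insert i s) | f i = k} := by
    rw [card_eq_sum_card_fiberwise (f := fun f : Numbering X ↦ f.symm k) (t := insert i s),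
      ← hcard, ← smul_eq_mul, ← sum_const]
    · refine sum_congr rfl fun j hj ↦ ?_
      simp only [Equiv.symm_apply_eq, eq_comm (a := k)]
      exact card_filter_prefixed_apply_eq hj (mem_insert_self i s) k
    · intro f hf
      have hf' : IsPrefix f (insert i s) := by simpa using hf
      rw [mem_coe, hf', hcard, Equiv.apply_symm_apply]
      exact Nat.lt_succ_self _
  rw [card_prefixed, hcard, Nat.factorial_succ, mul_assoc] at hsum
  rw [hfilter, ← Nat.eq_of_mul_eq_mul_left (Nat.succ_pos _) hsum, Nat.sub_sub, Nat.add_comm 1]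

open Finset Nat in
lemma Numbering.sum_filter_lt {X : Type*} [Fintype X] [DecidableEq X] (i : X)
    (g : Finset X → ℝ) :
    ∑ f : Numbering X, g {j | f j < f i} =
      ∑ s ∈ (univ.erase i).powerset, ((#s)! * (Fintype.card X - 1 - #s)! : ℝ) * g s := by
  rw [← sum_fiberwise_of_maps_to (g := fun f : Numbering X ↦ ({j | f j < f i} : Finset X))
    (t := (univ.erase i).powerset)]
  · refine sum_congr rfl fun s hs ↦ ?_
    have hi : i ∉ s := fun h ↦ by simpa using mem_powerset.1 hs h
    rw [sum_congr rfl fun f hf ↦ congrArg g (mem_filter.1 hf).2, sum_const,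
      card_filter_lt_eq hi, nsmul_eq_mul, Nat.cast_mul]
  · intro f _
    rw [mem_powerset]
    intro x hx
    rw [mem_filter_univ] at hx
    exact mem_erase.2 ⟨fun h ↦ by simp [h] at hx, mem_univ x⟩

lemma one_div_mul_inv_choose_sub_one {n k : ℕ} (hk : k ≤ n - 1) (hn : 0 < n) :
    (1 / (n : ℝ)) * (((n - 1).choose k : ℝ))⁻¹ =
      (k.factorial * (n - 1 - k).factorial : ℝ) / (n.factorial : ℝ) := by
  rw [Nat.cast_choose ℝ hk, ← Nat.mul_factorial_pred hn.ne', Nat.cast_mul, inv_div,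
    div_mul_div_comm, one_mul]


/-- The permutation form of the Shapley value equals the subset form: averaging the marginal
contribution of player `i` over its predecessor set in each of the `n!` permutations
(bijections `Fin n ≃ N`) equals `(1/n) Σ_{S ⊆ N\{i}} C(n-1,|S|)⁻¹ μ_i(S)`, which also equals
`Σ_{S ⊆ N\{i}} (|S|!(n-1-|S|)!/n!) μ_i(S)`. -/
theorem shapley_permutation_form_eq_subset_form
    {N : Type*} [Fintype N] [DecidableEq N]
    (v : Finset N → ℝ)
    (n : ℕ) (hn : n = Fintype.card N) (i : N) :
    ((1 / (n.factorial : ℝ)) * ∑ σ : Fin n ≃ N,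
        (v (insert i (Finset.univ.filter (fun j => σ.symm j < σ.symm i))) -
          v (Finset.univ.filter (fun j => σ.symm j < σ.symm i)))
      = (1 / (n : ℝ)) * ∑ S ∈ (Finset.univ.erase i).powerset,
          (((n - 1).choose S.card : ℝ))⁻¹ * (v (insert i S) - v S)) ∧
    ((1 / (n : ℝ)) * ∑ S ∈ (Finset.univ.erase i).powerset,
        (((n - 1).choose S.card : ℝ))⁻¹ * (v (insert i S) - v S)
      = ∑ S ∈ (Finset.univ.erase i).powerset,
          ((S.card.factorial * (n - 1 - S.card).factorial : ℝ) / (n.factorial : ℝ)) *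
            (v (insert i S) - v S)) := by
  have hsubset : (1 / (n : ℝ)) * ∑ S ∈ (Finset.univ.erase i).powerset,
        (((n - 1).choose S.card : ℝ))⁻¹ * (v (insert i S) - v S)
      = ∑ S ∈ (Finset.univ.erase i).powerset,
          ((S.card.factorial * (n - 1 - S.card).factorial : ℝ) / (n.factorial : ℝ)) *
            (v (insert i S) - v S) := by
    rw [Finset.mul_sum]
    refine Finset.sum_congr rfl fun S hS ↦ ?_
    have hcard : S.card ≤ n - 1 := by
      simpa [hn] using Finset.card_le_card (Finset.mem_powerset.1 hS)
    rw [← mul_assoc, one_div_mul_inv_choose_sub_one hcard (hn ▸ Fintype.card_pos_iff.2 ⟨i⟩)]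
  refine ⟨?_, hsubset⟩
  rw [hsubset]
  subst hn
  rw [Fintype.sum_equiv (Equiv.symmEquiv _ _)
      (fun σ : Fin (Fintype.card N) ≃ N ↦
        v (insert i (Finset.univ.filter fun j ↦ σ.symm j < σ.symm i)) -
          v (Finset.univ.filter fun j ↦ σ.symm j < σ.symm i))
      (fun f : Numbering N ↦ v (insert i (Finset.univ.filter fun j ↦ f j < f i)) -
        v (Finset.univ.filter fun j ↦ f j < f i)) fun _ ↦ rfl,
    Numbering.sum_filter_lt i fun S ↦ v (insert i S) - v S, Finset.mul_sum]
  refine Finset.sum_congr rfl fun S _ ↦ ?_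
  ring
end

section
/- Let G = (N, E, w) be a finite weighted hypergraph with nonnegative weights, and let v be the utility function of the associated edge synergy game. Then for every vertex i ∈ N, the Shapley value of i equals φ_i = Σ_{e ∈ E, i ∈ e} w(e)/|e|. -/
/-- The Shapley weights `1 / ((n + 1) * n.choose k)` satisfy a Pascal-type recursion. -/
theorem inv_succ_mul_choose_eq_add {n k : ℕ} (hk : k ≤ n) :
    (((n : ℝ) + 1) * (n.choose k : ℝ))⁻¹ =
      (((n + 1 : ℕ) + 1 : ℝ) * ((n + 1).choose k : ℝ))⁻¹ +
        (((n + 1 : ℕ) + 1 : ℝ) * ((n + 1).choose (k + 1) : ℝ))⁻¹ := by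
  obtain ⟨d, rfl⟩ := Nat.exists_eq_add_of_le hk
  have h₀ : (((k + d).choose k : ℕ) : ℝ) ≠ 0 := by
    exact_mod_cast (Nat.choose_pos hk).ne'
  have hleft : (((k + d + 1).choose k : ℕ) : ℝ) =
      (k + d + 1) * ((k + d).choose k : ℝ) / (d + 1) := by
    have h := Nat.choose_mul_succ_eq (k + d) k
    rw [show k + d + 1 - k = d + 1 by omega] at h
    rw [eq_div_iff (by positivity)]
    have h' : (((k + d).choose k : ℕ) : ℝ) * (k + d + 1) =
        ((k + d + 1).choose k : ℝ) * (d + 1) := by exact_mod_cast h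
    linarith
  have hright : (((k + d + 1).choose (k + 1) : ℕ) : ℝ) =
      (k + d + 1) * ((k + d).choose k : ℝ) / (k + 1) := by
    rw [eq_div_iff (by positivity)]
    exact_mod_cast (Nat.add_one_mul_choose_eq (k + d) k).symm
  rw [hleft, hright]
  push_cast
  have h₁ : (k : ℝ) + d + 1 ≠ 0 := by positivity
  have h₂ : (k : ℝ) + d + 1 + 1 ≠ 0 := by positivity
  field_simp
  ring

/-- The Shapley weights of the sets of the form `T ∪ R` with `R ⊆ D` and `#T = t`, `T` disjoint
from `D`, sum to `1 / (t + 1)`. -/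
theorem sum_powerset_inv_succ_mul_choose {α : Type*} [DecidableEq α] (t : ℕ) (D : Finset α) :
    ∑ R ∈ D.powerset,
      (((t + D.card : ℕ) + 1 : ℝ) * ((t + D.card).choose (t + R.card) : ℝ))⁻¹ =
        ((t : ℝ) + 1)⁻¹ := by
  induction D using Finset.induction_on with
  | empty => simp
  | insert x D hx ih =>
    rw [Finset.sum_powerset_insert hx, ← Finset.sum_add_distrib, ← ih]
    refine Finset.sum_congr rfl fun R hR => ?_
    have hRD := Finset.mem_powerset.mp hR
    rw [Finset.card_insert_of_notMem hx, Finset.card_insert_of_notMem fun h => hx (hRD h)]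
    exact (inv_succ_mul_choose_eq_add (Nat.add_le_add_left (Finset.card_le_card hRD) t)).symm

/-- The Shapley weights of the sets between `T` and `U` sum to `1 / (#T + 1)`. -/
theorem sum_Icc_inv_succ_mul_choose {α : Type*} [DecidableEq α] {T U : Finset α} (h : T ⊆ U) :
    ∑ S ∈ Finset.Icc T U, ((U.card + 1 : ℝ) * (U.card.choose S.card : ℝ))⁻¹ =
      ((T.card : ℝ) + 1)⁻¹ := by
  have hdisj {R : Finset α} (hR : R ∈ (U \ T).powerset) : Disjoint T R :=
    Finset.disjoint_sdiff.mono_right (Finset.mem_powerset.mp hR)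
  rw [Finset.Icc_eq_image_powerset h, Finset.sum_image fun R hR R' hR' hRR' => by
    rw [← Finset.union_sdiff_cancel_left (hdisj hR), hRR',
      Finset.union_sdiff_cancel_left (hdisj hR')],
    ← sum_powerset_inv_succ_mul_choose T.card (U \ T)]
  refine Finset.sum_congr rfl fun R hR => ?_
  rw [Finset.card_union_of_disjoint (hdisj hR), add_comm T.card (U \ T).card,
    Finset.card_sdiff_add_card_eq_card h]

/-- The marginal contribution of `i` to a coalition not containing it is the total weight of the
edges through `i` that the coalition completes. -/
theorem sum_subset_insert_sub_sum_subset {α : Type*} [DecidableEq α] (E : Finset (Finset α))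
    (w : Finset α → ℝ) {i : α} {S : Finset α} (hi : i ∉ S) :
    ∑ e ∈ E.filter (fun e => e ⊆ insert i S), w e - ∑ e ∈ E.filter (fun e => e ⊆ S), w e =
      ∑ e ∈ E.filter (fun e => i ∈ e), if e.erase i ⊆ S then w e else 0 := by
  simp only [Finset.sum_filter, ← Finset.sum_sub_distrib, Finset.subset_insert_iff]
  refine Finset.sum_congr rfl fun e _ => ?_
  by_cases hie : i ∈ e
  · have hne : ¬ e ⊆ S := fun h => hi (h hie)
    simp [hie, hne]
  · simp [hie]

/-- In the edge synergy game of a finite weighted hypergraph with nonnegative weights, the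
Shapley value of every vertex `i` equals `Σ_{e ∈ E, i ∈ e} w(e)/|e|`. -/
theorem edge_synergy_hypergraph_shapley
    {N : Type*} [Fintype N] [DecidableEq N]
    (E : Finset (Finset N)) (w : Finset N → ℝ)
    (hw : ∀ e ∈ E, 0 ≤ w e)
    (v : Finset N → ℝ)
    (hv : ∀ S : Finset N, v S = ∑ e ∈ E.filter (fun e => e ⊆ S), w e)
    (n : ℕ) (hn : n = Fintype.card N) (i : N) :
    (1 / (n : ℝ)) * ∑ S ∈ (Finset.univ.erase i).powerset,
        (((n - 1).choose S.card : ℝ))⁻¹ * (v (insert i S) - v S)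
      = ∑ e ∈ E.filter (fun e => i ∈ e), w e / (e.card : ℝ) := by
  have hcard : (Finset.univ.erase i).card = n - 1 := by
    rw [Finset.card_erase_of_mem (Finset.mem_univ i), Finset.card_univ, hn]
  have hpos : 0 < n := hn ▸ Fintype.card_pos_iff.mpr ⟨i⟩
  have hsucc : ((n - 1 : ℕ) : ℝ) + 1 = n := by exact_mod_cast Nat.sub_add_cancel hpos
  calc
    _ = ∑ S ∈ (Finset.univ.erase i).powerset, ∑ e ∈ E.filter (fun e => i ∈ e),
          if e.erase i ⊆ S then w e * ((n : ℝ) * ((n - 1).choose S.card : ℝ))⁻¹ else 0 := by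
      rw [Finset.mul_sum]
      refine Finset.sum_congr rfl fun S hS => ?_
      have hiS : i ∉ S := fun h => Finset.notMem_erase i _ (Finset.mem_powerset.mp hS h)
      rw [hv, hv, sum_subset_insert_sub_sum_subset E w hiS, Finset.mul_sum, Finset.mul_sum]
      refine Finset.sum_congr rfl fun e _ => ?_
      split_ifs
      · rw [mul_inv]
        ring
      · simp
    _ = ∑ e ∈ E.filter (fun e => i ∈ e), w e / (e.card : ℝ) := by
      rw [Finset.sum_comm]
      refine Finset.sum_congr rfl fun e he => ?_
      have hie := (Finset.mem_filter.mp he).2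
      have hIcc : (Finset.univ.erase i).powerset.filter (fun S => e.erase i ⊆ S) =
          Finset.Icc (e.erase i) (Finset.univ.erase i) := by
        ext S
        simp only [Finset.mem_filter, Finset.mem_powerset, Finset.mem_Icc]
        exact and_comm
      have hsum := sum_Icc_inv_succ_mul_choose
        (Finset.erase_subset_erase i (Finset.subset_univ e))
      rw [hcard, hsucc] at hsum
      rw [← Finset.sum_filter, hIcc, ← Finset.mul_sum, hsum, div_eq_mul_inv]
      congr 2
      exact_mod_cast Finset.card_erase_add_one hie
end

section
/- Let G = (N, E, w) be a finite weighted hypergraph with nonnegative weights, E nonempty, and let v be the utility function of the associated edge synergy game. Set k := max_{e ∈ E} |e| and for each vertex i let d(i) := Σ_{e ∈ E, i ∈ e} w(e). Then for every vertex i: (a) U_{max,i} = d(i); and (b) d(i) ≤ k · φ_i. Consequently the max-to-mean ratio of the edge synergy game satisfies Γ ≤ max_{e ∈ E} |e|. -/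
theorem Nat.inv_choose_succ_add_inv_choose_succ (t q : ℕ) :
    (((t + q + 2 : ℕ) : ℝ) * ((t + q + 1).choose t : ℝ))⁻¹
        + (((t + q + 2 : ℕ) : ℝ) * ((t + q + 1).choose (t + 1) : ℝ))⁻¹
      = (((t + q + 1 : ℕ) : ℝ) * ((t + q).choose t : ℝ))⁻¹ := by
  have h₀ : (0 : ℝ) < ((t + q).choose t : ℝ) := by
    exact_mod_cast Nat.choose_pos (Nat.le_add_right t q)
  have h₁ : ((t + q + 1).choose t : ℝ) = (t + q + 1) * ((t + q).choose t : ℝ) / (q + 1) := by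
    have h := Nat.choose_mul_succ_eq (t + q) t
    rw [show t + q + 1 - t = q + 1 by omega] at h
    rw [eq_div_iff (by positivity), mul_comm (_ + _ : ℝ)]
    exact_mod_cast h.symm
  have h₂ : ((t + q + 1).choose (t + 1) : ℝ)
      = (t + q + 1) * ((t + q).choose t : ℝ) / (t + 1) := by
    rw [eq_div_iff (by positivity)]
    exact_mod_cast (Nat.add_one_mul_choose_eq (t + q) t).symm
  rw [h₁, h₂]
  push_cast
  field_simp
  ring

theorem Finset.sum_powerset_inv_choose_add_card {α : Type*} [DecidableEq α] (B : Finset α)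
    (t q : ℕ) :
    ∑ U ∈ B.powerset, ((t + q + B.card).choose (t + U.card) : ℝ)⁻¹
      = ((t + q + B.card + 1 : ℕ) : ℝ) * (((t + q + 1 : ℕ) : ℝ) * ((t + q).choose t : ℝ))⁻¹ := by
  induction B using Finset.induction_on generalizing t q with
  | empty =>
    have h : ((t + q + 1 : ℕ) : ℝ) ≠ 0 := by positivity
    simp only [powerset_empty, sum_singleton, card_empty, add_zero, mul_inv]
    rw [mul_inv_cancel_left₀ h]
  | insert a B ha ih =>
    have hins : ∀ U ∈ B.powerset, t + (insert a U).card = t + 1 + U.card := fun U hU => by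
      rw [card_insert_of_notMem fun h => ha (mem_powerset.1 hU h), add_assoc, add_comm 1]
    have h₁ := ih t (q + 1)
    have h₂ := ih (t + 1) q
    rw [← add_assoc, show t + q + 1 + B.card = t + q + (B.card + 1) by omega] at h₁
    rw [add_right_comm t 1 q, show t + q + 1 + B.card = t + q + (B.card + 1) by omega] at h₂
    rw [sum_powerset_insert ha, card_insert_of_notMem ha,
      ← Nat.inv_choose_succ_add_inv_choose_succ, mul_add, h₁,
      sum_congr rfl fun U hU => by rw [hins U hU], h₂]

theorem Finset.sum_inv_choose_card_of_subset {α : Type*} [DecidableEq α] {T A : Finset α}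
    (h : T ⊆ A) :
    ∑ S ∈ A.powerset with T ⊆ S, (A.card.choose S.card : ℝ)⁻¹
      = ((A.card + 1 : ℕ) : ℝ) / ((T.card + 1 : ℕ) : ℝ) := by
  have hset : A.powerset.filter (T ⊆ ·) = (A \ T).powerset.image (T ∪ ·) := by
    rw [← Icc_eq_image_powerset h]
    ext S
    simp [and_comm]
  have hdisj : ∀ U ∈ (A \ T).powerset, Disjoint T U := fun U hU =>
    disjoint_sdiff.mono_right (mem_powerset.1 hU)
  have hinj : Set.InjOn (T ∪ ·) ((A \ T).powerset : Set (Finset α)) := by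
    intro U hU V hV hUV
    have hU' := union_sdiff_cancel_left (hdisj U hU)
    rw [← hU', ← union_sdiff_cancel_left (hdisj V hV)]
    exact congrArg (· \ T) hUV
  have hcard : T.card + 0 + (A \ T).card = A.card := by
    rw [add_zero, add_comm, card_sdiff_add_card_eq_card h]
  have hsum := sum_powerset_inv_choose_add_card (A \ T) T.card 0
  rw [hcard] at hsum
  rw [hset, sum_image hinj, sum_congr rfl fun U hU => by rw [card_union_of_disjoint (hdisj U hU)],
    hsum]
  simp [div_eq_mul_inv]

section EdgeSynergy

variable {N : Type*} [DecidableEq N]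

theorem edgeSynergy_marginal (E : Finset (Finset N)) (w : Finset N → ℝ) {i : N} {S : Finset N}
    (hi : i ∉ S) :
    ∑ e ∈ E.filter (fun e => e ⊆ insert i S), w e - ∑ e ∈ E.filter (fun e => e ⊆ S), w e
      = ∑ e ∈ E.filter (fun e => i ∈ e), if e.erase i ⊆ S then w e else 0 := by
  rw [Finset.sum_filter, Finset.sum_filter, Finset.sum_filter, ← Finset.sum_sub_distrib]
  refine Finset.sum_congr rfl fun e _ => ?_
  simp_rw [← Finset.subset_insert_iff]
  by_cases hie : i ∈ e
  · have : ¬ e ⊆ S := fun h => hi (h hie)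
    simp [hie, this]
  · simp [hie, Finset.subset_insert_iff_of_notMem hie]

theorem edgeSynergy_shapley [Fintype N] (E : Finset (Finset N)) (w : Finset N → ℝ) (i : N) :
    (1 / (Fintype.card N : ℝ)) * ∑ S ∈ (Finset.univ.erase i).powerset,
        ((Fintype.card N - 1).choose S.card : ℝ)⁻¹ *
          ∑ e ∈ E.filter (fun e => i ∈ e), (if e.erase i ⊆ S then w e else 0)
      = ∑ e ∈ E.filter (fun e => i ∈ e), w e / e.card := by
  have hpos : 0 < Fintype.card N := Fintype.card_pos_iff.2 ⟨i⟩
  have hcard : (Finset.univ.erase i).card = Fintype.card N - 1 := by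
    rw [Finset.card_erase_of_mem (Finset.mem_univ i), Finset.card_univ]
  rw [Finset.sum_congr rfl fun S _ => Finset.mul_sum .., Finset.sum_comm, Finset.mul_sum]
  refine Finset.sum_congr rfl fun e he => ?_
  have hie : i ∈ e := (Finset.mem_filter.1 he).2
  have h := Finset.sum_inv_choose_card_of_subset
    (Finset.erase_subset_erase i (Finset.subset_univ e))
  rw [hcard, Finset.card_erase_add_one hie, Nat.sub_add_cancel hpos, Finset.sum_filter] at h
  have hsum : ∑ S ∈ (Finset.univ.erase i).powerset,
      ((Fintype.card N - 1).choose S.card : ℝ)⁻¹ * (if e.erase i ⊆ S then w e else 0)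
        = (Fintype.card N : ℝ) / e.card * w e := by
    rw [← h, Finset.sum_mul]
    refine Finset.sum_congr rfl fun S _ => ?_
    split_ifs <;> simp
  have hn : (Fintype.card N : ℝ) ≠ 0 := by exact_mod_cast hpos.ne'
  rw [hsum]
  field_simp

end EdgeSynergy


/-- In the edge synergy game of a finite weighted hypergraph with nonnegative weights and
`E ≠ ∅`, setting `k := max_{e ∈ E} |e|` and `d(i) := Σ_{e ∈ E, i ∈ e} w(e)`, every vertex `i`
satisfies (a) `U_{max,i} = d(i)` and (b) `d(i) ≤ k * φ_i`; consequently the max-to-mean ratio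
of the game satisfies `Γ ≤ max_{e ∈ E} |e|`. -/
theorem edge_synergy_gamma_ratio
    {N : Type*} [Fintype N] [DecidableEq N] [Nonempty N]
    (E : Finset (Finset N)) (hE : E.Nonempty) (w : Finset N → ℝ)
    (hw : ∀ e ∈ E, 0 ≤ w e)
    (v : Finset N → ℝ)
    (hv : ∀ S : Finset N, v S = ∑ e ∈ E.filter (fun e => e ⊆ S), w e)
    (n : ℕ) (hn : n = Fintype.card N) :
    (∀ i : N,
      ((Finset.univ.erase i).powerset.sup' ⟨∅, Finset.empty_mem_powerset _⟩
          (fun S => v (insert i S) - v S))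
        = ∑ e ∈ E.filter (fun e => i ∈ e), w e) ∧
    (∀ i : N,
      (∑ e ∈ E.filter (fun e => i ∈ e), w e)
        ≤ ((E.sup' hE (fun e => e.card) : ℕ) : ℝ) *
          ((1 / (n : ℝ)) * ∑ S ∈ (Finset.univ.erase i).powerset,
            (((n - 1).choose S.card : ℝ))⁻¹ * (v (insert i S) - v S))) ∧
    (Finset.univ.sup' Finset.univ_nonempty
        (fun i : N =>
          ((Finset.univ.erase i).powerset.sup' ⟨∅, Finset.empty_mem_powerset _⟩
            (fun S => v (insert i S) - v S)) /
          ((1 / (n : ℝ)) * ∑ S ∈ (Finset.univ.erase i).powerset,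
            (((n - 1).choose S.card : ℝ))⁻¹ * (v (insert i S) - v S)))
      ≤ ((E.sup' hE (fun e => e.card) : ℕ) : ℝ)) := by

  subst hn
  have hμ : ∀ i : N, ∀ S ∈ (Finset.univ.erase i).powerset, v (insert i S) - v S
      = ∑ e ∈ E.filter (fun e => i ∈ e), if e.erase i ⊆ S then w e else 0 := by
    intro i S hS
    rw [hv, hv]
    exact edgeSynergy_marginal E w fun h =>
      Finset.notMem_erase i _ (Finset.mem_powerset.1 hS h)
  have hφ : ∀ i : N, (1 / (Fintype.card N : ℝ)) * ∑ S ∈ (Finset.univ.erase i).powerset,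
      (((Fintype.card N - 1).choose S.card : ℝ))⁻¹ * (v (insert i S) - v S)
        = ∑ e ∈ E.filter (fun e => i ∈ e), w e / e.card := by
    intro i
    rw [← edgeSynergy_shapley, Finset.sum_congr rfl fun S hS => by rw [hμ i S hS]]
  have hw' : ∀ i : N, ∀ e ∈ E.filter (fun e => i ∈ e), 0 ≤ w e := fun i e he =>
    hw e (Finset.mem_filter.1 he).1
  have hmax : ∀ i : N, ((Finset.univ.erase i).powerset.sup' ⟨∅, Finset.empty_mem_powerset _⟩
      (fun S => v (insert i S) - v S)) = ∑ e ∈ E.filter (fun e => i ∈ e), w e := by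
    intro i
    apply le_antisymm
    · refine Finset.sup'_le _ _ fun S hS => ?_
      rw [hμ i S hS]
      refine Finset.sum_le_sum fun e he => ?_
      split_ifs
      · exact le_rfl
      · exact hw' i e he
    · have hmem := Finset.mem_powerset_self (Finset.univ.erase i)
      refine le_trans (le_of_eq ?_) (Finset.le_sup' _ hmem)
      rw [hμ i _ hmem]
      refine Finset.sum_congr rfl fun e _ => ?_
      rw [if_pos (Finset.erase_subset_erase i (Finset.subset_univ e))]
  have hle : ∀ i : N, ∑ e ∈ E.filter (fun e => i ∈ e), w e
      ≤ ((E.sup' hE (fun e => e.card) : ℕ) : ℝ)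
        * ∑ e ∈ E.filter (fun e => i ∈ e), w e / e.card := by
    intro i
    rw [Finset.mul_sum]
    refine Finset.sum_le_sum fun e he => ?_
    obtain ⟨heE, hie⟩ := Finset.mem_filter.1 he
    have hpos : (0 : ℝ) < e.card := by exact_mod_cast Finset.card_pos.2 ⟨i, hie⟩
    have hk : (e.card : ℝ) ≤ ((E.sup' hE (fun e => e.card) : ℕ) : ℝ) := by
      exact_mod_cast Finset.le_sup' (fun e : Finset N => e.card) heE
    rw [mul_div_assoc', le_div_iff₀ hpos, mul_comm]
    exact mul_le_mul_of_nonneg_right hk (hw e heE)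
  refine ⟨hmax, fun i => ?_, Finset.sup'_le _ _ fun i _ => ?_⟩
  · rw [hφ]
    exact hle i
  · rw [hmax, hφ]
    exact div_le_of_le_mul₀
      (Finset.sum_nonneg fun e he => div_nonneg (hw' i e he) (Nat.cast_nonneg _))
      (Nat.cast_nonneg _) (hle i)
end

section
/- Let (N, v) be a coalitional game with n ≥ 2 players whose utility function v is supermodular, and let i*, i ∈ N be distinct players. Define φ'_{i*} := Σ_{S ⊆ N\{i*, i}} (|S|! · (n−|S|−2)! / (n−1)!) · μ_{i*}(S ∪ {i}), which is the expected reward of i* under a uniformly random permutation of N conditioned on player i being at the least preferable (first) rank. Then φ'_{i*} ≥ φ_{i*}, where φ_{i*} = Σ_{S ⊆ N\{i*}} (|S|! · (n−|S|−1)! / n!) · μ_{i*}(S) is the Shapley value of i*. In fact φ'_{i*} − φ_{i*} = Σ_{S ⊆ N\{i*, i}} (|S|! · (n−|S|−1)! / n!) · (μ_{i*}(S ∪ {i}) − μ_{i*}(S)) ≥ 0. -/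
/-- Splitting the weight of a coalition of size `s` according to whether one further player is
among the predecessors. -/
theorem shapley_weight_split {n s : ℕ} (h : s + 2 ≤ n) :
    ((s.factorial * (n - s - 2).factorial : ℝ) / ((n - 1).factorial : ℝ))
      = (s.factorial * (n - s - 1).factorial : ℝ) / (n.factorial : ℝ)
        + ((s + 1).factorial * (n - (s + 1) - 1).factorial : ℝ) / (n.factorial : ℝ) := by
  obtain ⟨k, rfl⟩ := Nat.exists_eq_add_of_le h
  have h1 : s + 2 + k - s - 2 = k := by omega
  have h2 : s + 2 + k - s - 1 = k + 1 := by omega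
  have h3 : s + 2 + k - (s + 1) - 1 = k := by omega
  have h4 : s + 2 + k - 1 = s + k + 1 := by omega
  have h5 : s + 2 + k = s + k + 1 + 1 := by omega
  rw [h1, h2, h3, h4, h5, Nat.factorial_succ (s + k + 1), Nat.factorial_succ k,
    Nat.factorial_succ s]
  have := Nat.cast_ne_zero (R := ℝ).2 (Nat.factorial_ne_zero (s + k + 1))
  push_cast
  field_simp
  ring

/-- In a supermodular game the marginal contribution of `j` does not decrease when another
player joins the coalition. -/
theorem marginal_le_marginal_insert {N : Type*} [DecidableEq N] {v : Finset N → ℝ}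
    (hsup : ∀ S T : Finset N, v S + v T ≤ v (S ∪ T) + v (S ∩ T))
    {j i : N} (hne : j ≠ i) {S : Finset N} (hj : j ∉ S) :
    v (insert j S) - v S ≤ v (insert j (insert i S)) - v (insert i S) := by
  have h := hsup (insert j S) (insert i S)
  have hU : insert j S ∪ insert i S = insert j (insert i S) := by
    ext x; simp only [Finset.mem_union, Finset.mem_insert]; tauto
  have hI : insert j S ∩ insert i S = S := by
    ext x
    simp only [Finset.mem_inter, Finset.mem_insert]
    constructor
    · rintro ⟨rfl | hx, hx'⟩
      · exact hx'.resolve_left hne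
      · exact hx
    · exact fun hx => ⟨Or.inr hx, Or.inr hx⟩
  rw [hU, hI] at h
  linarith

/-- Punishing a perpetual violating player: in a supermodular game, conditioning a uniformly
random permutation on a player `i ≠ i*` being at the least preferable (first) rank cannot
decrease the expected reward of `i*`. Namely, `φ'_{i*} ≥ φ_{i*}`, and in fact
`φ'_{i*} - φ_{i*} = Σ_{S ⊆ N\{i*,i}} (|S|!(n-|S|-1)!/n!) (μ_{i*}(S∪{i}) - μ_{i*}(S)) ≥ 0`. -/
theorem punish_violating_player
    {N : Type*} [Fintype N] [DecidableEq N]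
    (v : Finset N → ℝ)
    (hsup : ∀ S T : Finset N, v S + v T ≤ v (S ∪ T) + v (S ∩ T))
    (n : ℕ) (hn : n = Fintype.card N) (hn2 : 2 ≤ n)
    (istar i : N) (hne : istar ≠ i) :
    ((∑ S ∈ ((Finset.univ.erase istar).erase i).powerset,
        ((S.card.factorial * (n - S.card - 2).factorial : ℝ) / ((n - 1).factorial : ℝ)) *
          (v (insert istar (insert i S)) - v (insert i S)))
      - (∑ S ∈ (Finset.univ.erase istar).powerset,
        ((S.card.factorial * (n - S.card - 1).factorial : ℝ) / (n.factorial : ℝ)) *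
          (v (insert istar S) - v S))
      = ∑ S ∈ ((Finset.univ.erase istar).erase i).powerset,
        ((S.card.factorial * (n - S.card - 1).factorial : ℝ) / (n.factorial : ℝ)) *
          ((v (insert istar (insert i S)) - v (insert i S)) - (v (insert istar S) - v S))) ∧
    (0 ≤ ∑ S ∈ ((Finset.univ.erase istar).erase i).powerset,
        ((S.card.factorial * (n - S.card - 1).factorial : ℝ) / (n.factorial : ℝ)) *
          ((v (insert istar (insert i S)) - v (insert i S)) - (v (insert istar S) - v S))) ∧
    ((∑ S ∈ (Finset.univ.erase istar).powerset,
        ((S.card.factorial * (n - S.card - 1).factorial : ℝ) / (n.factorial : ℝ)) *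
          (v (insert istar S) - v S))
      ≤ ∑ S ∈ ((Finset.univ.erase istar).erase i).powerset,
        ((S.card.factorial * (n - S.card - 2).factorial : ℝ) / ((n - 1).factorial : ℝ)) *
          (v (insert istar (insert i S)) - v (insert i S))) := by
  have hi : i ∉ (Finset.univ.erase istar).erase i := Finset.notMem_erase _ _
  have hins : Finset.univ.erase istar = insert i ((Finset.univ.erase istar).erase i) :=
    (Finset.insert_erase (by simp [hne.symm])).symm
  have hcard : ((Finset.univ.erase istar).erase i).card = n - 2 := by
    rw [Finset.card_erase_of_mem (by simp [hne.symm]),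
      Finset.card_erase_of_mem (Finset.mem_univ _), Finset.card_univ, hn]
    omega
  refine (fun heq hnonneg => ⟨heq, hnonneg, by linarith⟩) ?_ ?_
  · conv_lhs => rw [sub_eq_add_neg]; arg 2; rw [hins, Finset.sum_powerset_insert hi]
    rw [← sub_eq_add_neg, ← Finset.sum_add_distrib, ← Finset.sum_sub_distrib]
    refine Finset.sum_congr rfl fun S hS => ?_
    have hsub := Finset.mem_powerset.1 hS
    have hle := Finset.card_le_card hsub
    rw [Finset.card_insert_of_notMem fun h => hi (hsub h),
      shapley_weight_split (n := n) (s := S.card) (by omega)]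
    ring
  · refine Finset.sum_nonneg fun S hS => mul_nonneg (by positivity) (sub_nonneg.2 ?_)
    refine marginal_le_marginal_insert hsup hne fun h => ?_
    simpa using Finset.mem_powerset.1 hS h
end

section
/- Let n ≥ 4 be an even integer, N a set of n players, i* ∈ N, and Q ⊆ N with i* ∉ Q and |Q| = n/2. Let α > 0 and define v : 2^N → ℝ by v(N) = 2α; v(N\{q}) = α for each q ∈ {i*} ∪ Q; and v(S) = 0 for every other S ⊆ N. Then v is nonnegative, monotone and supermodular. -/
/-- The complement of a singleton is a coatom: its only supersets are itself and `univ`. -/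
theorem eq_univ_or_eq_erase_of_erase_subset {N : Type*} [Fintype N] [DecidableEq N]
    {q : N} {T : Finset N} (h : Finset.univ.erase q ⊆ T) :
    T = Finset.univ ∨ T = Finset.univ.erase q := by
  by_cases hq : q ∈ T
  · refine Or.inl (Finset.eq_univ_of_forall fun x => ?_)
    by_cases hx : x = q
    · rwa [hx]
    · exact h (by simpa using hx)
  · exact Or.inr ((Finset.subset_erase.2 ⟨Finset.subset_univ T, hq⟩).antisymm h)

/-- The synthetic lower-bound game: for even `n ≥ 4`, `i* ∉ Q`, `|Q| = n/2`, `α > 0`, the game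
with `v(N) = 2α`, `v(N\{q}) = α` for `q ∈ {i*} ∪ Q`, and `v(S) = 0` otherwise, is
nonnegative, monotone and supermodular. -/
theorem synthetic_game_supermodular
    {N : Type*} [Fintype N] [DecidableEq N]
    (n : ℕ) (hn : n = Fintype.card N) (hn4 : 4 ≤ n) (heven : Even n)
    (istar : N) (Q : Finset N) (hiQ : istar ∉ Q) (hQcard : Q.card = n / 2)
    (α : ℝ) (hα : 0 < α)
    (v : Finset N → ℝ)
    (hv1 : v Finset.univ = 2 * α)
    (hv2 : ∀ q ∈ insert istar Q, v (Finset.univ.erase q) = α)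
    (hv3 : ∀ S : Finset N, S ≠ Finset.univ →
      (∀ q ∈ insert istar Q, S ≠ Finset.univ.erase q) → v S = 0) :
    (∀ S : Finset N, 0 ≤ v S) ∧
    (∀ S T : Finset N, S ⊆ T → v S ≤ v T) ∧
    (∀ S T : Finset N, v S + v T ≤ v (S ∪ T) + v (S ∩ T)) := by
  have values (S : Finset N) : (S = Finset.univ ∧ v S = 2 * α) ∨
      ((∃ q, S = Finset.univ.erase q) ∧ v S = α) ∨ v S = 0 := by
    by_cases hS : S = Finset.univ
    · exact Or.inl ⟨hS, hS ▸ hv1⟩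
    · by_cases h : ∃ q ∈ insert istar Q, S = Finset.univ.erase q
      · obtain ⟨q, hq, rfl⟩ := h
        exact Or.inr (Or.inl ⟨⟨q, rfl⟩, hv2 q hq⟩)
      · push Not at h
        exact Or.inr (Or.inr (hv3 S hS h))
  have nonneg (S : Finset N) : 0 ≤ v S := by
    rcases values S with ⟨-, h⟩ | ⟨-, h⟩ | h <;> linarith
  have le_of_ne_univ {S : Finset N} (hS : S ≠ Finset.univ) : v S ≤ α := by
    rcases values S with ⟨h, -⟩ | ⟨-, h⟩ | h
    · exact absurd h hS
    all_goals linarith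
  refine ⟨nonneg, fun S T hST => ?_, fun S T => ?_⟩
  · rcases values S with ⟨rfl, -⟩ | ⟨⟨q, rfl⟩, h⟩ | h
    · rw [Finset.univ_subset_iff.1 hST]
    · rcases eq_univ_or_eq_erase_of_erase_subset hST with rfl | rfl <;> linarith
    · exact h ▸ nonneg T
  · by_cases hST : S ⊆ T
    · rw [Finset.union_eq_right.2 hST, Finset.inter_eq_left.2 hST, add_comm]
    by_cases hTS : T ⊆ S
    · rw [Finset.union_eq_left.2 hTS, Finset.inter_eq_right.2 hTS]
    have hS : v S ≤ α := le_of_ne_univ fun h => hTS (h ▸ Finset.subset_univ T)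
    have hT : v T ≤ α := le_of_ne_univ fun h => hST (h ▸ Finset.subset_univ S)
    have hinter := nonneg (S ∩ T)
    by_cases hunion : S ∪ T = Finset.univ
    · rw [hunion, hv1]
      linarith
    have eq_zero (A B : Finset N) (hBA : ¬ B ⊆ A) (hAB : A ∪ B ≠ Finset.univ) : v A = 0 := by
      rcases values A with ⟨rfl, -⟩ | ⟨⟨q, rfl⟩, -⟩ | h
      · exact absurd (Finset.subset_univ B) hBA
      · rcases eq_univ_or_eq_erase_of_erase_subset
          (Finset.subset_union_left (s₂ := B)) with h | h
        · exact absurd h hAB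
        · exact absurd (Finset.union_eq_left.1 h) hBA
      · exact h
    rw [eq_zero S T hTS hunion, eq_zero T S hST (Finset.union_comm S T ▸ hunion)]
    linarith [nonneg (S ∪ T)]
end

section
/- Let n ≥ 4 be an even integer, N a set of n players, i* ∈ N, and Q ⊆ N with i* ∉ Q and |Q| = n/2. Let α > 0 and define v : 2^N → ℝ by v(N) = 2α; v(N\{q}) = α for each q ∈ {i*} ∪ Q; and v(S) = 0 for every other S ⊆ N. Then for every player i ∈ {i*} ∪ Q, the Shapley value of i equals φ_i = α·(1/n + (n/2)/(n(n−1))) = α·(3n−2)/(2n(n−1)). In particular, φ_i = 1 when α = 2n(n−1)/(3n−2). -/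
/-- In the synthetic lower-bound game (even `n ≥ 4`, `i* ∉ Q`, `|Q| = n/2`, `v(N) = 2α`,
`v(N\{q}) = α` for `q ∈ {i*} ∪ Q`, `v(S) = 0` otherwise), every player `i ∈ {i*} ∪ Q` has
Shapley value `φ_i = α(1/n + (n/2)/(n(n-1))) = α(3n-2)/(2n(n-1))`; in particular `φ_i = 1`
when `α = 2n(n-1)/(3n-2)`. -/
theorem synthetic_game_shapley
    {N : Type*} [Fintype N] [DecidableEq N]
    (n : ℕ) (hn : n = Fintype.card N) (hn4 : 4 ≤ n) (heven : Even n)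
    (istar : N) (Q : Finset N) (hiQ : istar ∉ Q) (hQcard : Q.card = n / 2)
    (α : ℝ) (hα : 0 < α)
    (v : Finset N → ℝ)
    (hv1 : v Finset.univ = 2 * α)
    (hv2 : ∀ q ∈ insert istar Q, v (Finset.univ.erase q) = α)
    (hv3 : ∀ S : Finset N, S ≠ Finset.univ →
      (∀ q ∈ insert istar Q, S ≠ Finset.univ.erase q) → v S = 0)
    (i : N) (hi : i ∈ insert istar Q) :
    ((1 / (n : ℝ)) * ∑ S ∈ (Finset.univ.erase i).powerset,
        (((n - 1).choose S.card : ℝ))⁻¹ * (v (insert i S) - v S)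
      = α * (1 / (n : ℝ) + ((n : ℝ) / 2) / ((n : ℝ) * ((n : ℝ) - 1)))) ∧
    ((1 / (n : ℝ)) * ∑ S ∈ (Finset.univ.erase i).powerset,
        (((n - 1).choose S.card : ℝ))⁻¹ * (v (insert i S) - v S)
      = α * (3 * (n : ℝ) - 2) / (2 * (n : ℝ) * ((n : ℝ) - 1))) ∧
    (α = 2 * (n : ℝ) * ((n : ℝ) - 1) / (3 * (n : ℝ) - 2) →
      (1 / (n : ℝ)) * ∑ S ∈ (Finset.univ.erase i).powerset,
        (((n - 1).choose S.card : ℝ))⁻¹ * (v (insert i S) - v S) = 1) := by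
  subst hn
  set n := Fintype.card N with hn
  have hR : ((insert istar Q).erase i).card = n / 2 := by
    rw [Finset.card_erase_of_mem hi, Finset.card_insert_of_notMem hiQ, hQcard]
    rfl
  have hcard : (Finset.univ.erase i).card = n - 1 := by
    rw [Finset.card_erase_of_mem (Finset.mem_univ i), Finset.card_univ]
  have hv_zero : ∀ S : Finset N, i ∉ S → S ≠ Finset.univ.erase i → v S = 0 := by
    intro S hiS hS
    refine hv3 S (fun h => hiS (h ▸ Finset.mem_univ i)) ?_
    rintro q - rfl
    have hqi : i = q := by simpa using hiS
    exact hS (by rw [hqi])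
  have hins : ∀ q, q ≠ i →
      insert i ((Finset.univ.erase i).erase q) = Finset.univ.erase q := by
    intro q hq
    ext x
    by_cases hx : x = i <;> simp [hx, hq.symm]
  have hsum : ∑ S ∈ (Finset.univ.erase i).powerset,
      (((n - 1).choose S.card : ℝ))⁻¹ * (v (insert i S) - v S)
      = α + ((n : ℝ) / 2) * (((n : ℝ) - 1)⁻¹ * α) := by
    have hsub : insert (Finset.univ.erase i)
        (((insert istar Q).erase i).image fun q => (Finset.univ.erase i).erase q)
        ⊆ (Finset.univ.erase i).powerset := by
      refine Finset.insert_subset (Finset.mem_powerset_self _) ?_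
      refine Finset.image_subset_iff.2 fun q _ => ?_
      exact Finset.mem_powerset.2 (Finset.erase_subset _ _)
    rw [← Finset.sum_subset hsub, Finset.sum_insert, Finset.sum_image]
    · congr 1
      · rw [hcard, Finset.insert_erase (Finset.mem_univ i), hv1, hv2 i hi, Nat.choose_self]
        push_cast
        ring
      · rw [Finset.sum_congr rfl (g := fun _ => ((n : ℝ) - 1)⁻¹ * α), Finset.sum_const, hR,
          nsmul_eq_mul, Nat.cast_div heven.two_dvd two_ne_zero, Nat.cast_ofNat]
        intro q hq
        obtain ⟨hqi, hq⟩ := Finset.mem_erase.1 hq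
        have hmem : q ∈ Finset.univ.erase i := by simp [hqi]
        rw [hins q hqi, hv2 q hq, hv_zero _ (by simp) (fun h => Finset.erase_ne_self.2 hmem h),
          Finset.card_erase_of_mem hmem, hcard, Nat.choose_symm (by omega), Nat.choose_one_right,
          Nat.cast_sub (by omega), Nat.cast_one, sub_zero]
    · intro a ha b hb hab
      have haE : a ∈ Finset.univ.erase i := by
        simpa using (Finset.mem_erase.1 (Finset.mem_coe.1 ha)).1
      exact Finset.erase_injOn _ haE
        (by simpa using (Finset.mem_erase.1 (Finset.mem_coe.1 hb)).1) hab
    · rw [Finset.mem_image]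
      rintro ⟨q, hq, h⟩
      exact Finset.erase_ne_self.2 (by simpa using (Finset.mem_erase.1 hq).1) h
    · intro S hS hS'
      have hiS : i ∉ S := fun h => by simpa using Finset.mem_powerset.1 hS h
      rw [Finset.mem_insert, not_or] at hS'
      obtain ⟨hne, hnot⟩ := hS'
      have hv_insert : v (insert i S) = 0 := by
        apply hv3
        · intro h
          exact hne (by rw [← h, Finset.erase_insert hiS])
        · intro q hq h
          have hqi : q ≠ i := by
            rintro rfl
            exact Finset.notMem_erase q _ (h ▸ Finset.mem_insert_self q S)
          refine hnot (Finset.mem_image.2 ⟨q, Finset.mem_erase.2 ⟨hqi, hq⟩, ?_⟩)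
          rw [Finset.erase_right_comm, ← h, Finset.erase_insert hiS]
      rw [hv_insert, hv_zero S hiS hne]
      simp
  have hn_real : (4 : ℝ) ≤ n := by exact_mod_cast hn4
  have h0 : (n : ℝ) ≠ 0 := by positivity
  have h1 : (n : ℝ) - 1 ≠ 0 := by linarith
  have h2 : 3 * (n : ℝ) - 2 ≠ 0 := by linarith
  rw [hsum]
  refine ⟨?_, ?_, ?_⟩
  · field_simp
  · field_simp
    ring
  · intro h
    have h3 : α * (3 * n - 2) = 2 * n * (n - 1) := by rw [h, div_mul_cancel₀ _ h2]
    field_simp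
    linarith
end

section
/- Let n ≥ 100 be an even integer, let ε be a real number with 1/n ≤ ε ≤ 0.01, let s be an integer with 0 ≤ s ≤ ε·n, and set α := 2n(n−1)/(3n−2). Then (α/(n−s)) · ( 1 + (n/2 − s)/(n−s−1) ) ≤ 1 + 2ε. -/
/-- Reward bound after removing violating players: for even `n ≥ 100`, `1/n ≤ ε ≤ 0.01`,
integer `0 ≤ s ≤ εn`, and `α = 2n(n-1)/(3n-2)`, the honest player's per-sample expected
reward satisfies `(α/(n-s))(1 + (n/2 - s)/(n-s-1)) ≤ 1 + 2ε`. -/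
theorem reward_bound_after_removals
    (n : ℕ) (hn : 100 ≤ n) (heven : Even n)
    (ε : ℝ) (hε1 : 1 / (n : ℝ) ≤ ε) (hε2 : ε ≤ 0.01)
    (s : ℕ) (hs : (s : ℝ) ≤ ε * (n : ℝ))
    (α : ℝ) (hα : α = 2 * (n : ℝ) * ((n : ℝ) - 1) / (3 * (n : ℝ) - 2)) :
    α / ((n : ℝ) - s) * (1 + ((n : ℝ) / 2 - (s : ℝ)) / ((n : ℝ) - s - 1)) ≤ 1 + 2 * ε := by
  have hN : (100 : ℝ) ≤ n := by exact_mod_cast hn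
  have hS : (0 : ℝ) ≤ s := Nat.cast_nonneg s
  generalize (n : ℝ) = N at *
  generalize (s : ℝ) = S at *
  have hN0 : 0 < N := by linarith
  have hSN : S ≤ 0.01 * N := hs.trans (mul_le_mul_of_nonneg_right hε2 hN0.le)
  have h1 : 0 < N - S - 1 := by linarith
  have h2 : 0 < N - S := by linarith
  have h3 : 0 < 3 * N - 2 := by linarith
  have hle : S / N ≤ ε := (div_le_iff₀ hN0).2 hs
  have hform : α / (N - S) * (1 + (N / 2 - S) / (N - S - 1)) =
      N * (N - 1) * (3 * N - 2 - 4 * S) / ((3 * N - 2) * (N - S) * (N - S - 1)) := by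
    rw [hα]
    field_simp
    ring
  have hrhs : 1 + 2 * (S / N) = (N + 2 * S) / N := by
    field_simp
  have hbracket : 0 ≤ 4 * N ^ 2 * (N - 1) - (3 * N - 2) * (N + 3 * N * S - 2 * S - 2 * S ^ 2) := by
    have hupper : (3 * N - 2) * (N + 3 * N * S - 2 * S - 2 * S ^ 2) ≤
        3 * N * (N + 3 * N * (0.01 * N)) := by
      have hNS : N * S ≤ N * (0.01 * N) := mul_le_mul_of_nonneg_left hSN hN0.le
      have hNN : 0 ≤ N * (0.01 * N) := by positivity
      exact mul_le_mul_of_nonneg (by linarith) (by nlinarith [sq_nonneg S]) h3.le (by nlinarith)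
    nlinarith [mul_nonneg (sq_nonneg N) (sub_nonneg.2 hN), sq_nonneg N]
  calc _ ≤ 1 + 2 * (S / N) := by
        rw [hform, hrhs, div_le_div_iff₀ (by positivity) hN0]
        linear_combination mul_nonneg hS hbracket
    _ ≤ 1 + 2 * ε := by linarith
end
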